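/- arXiv:math/9508206 — 2 statements merged into one kernel-verified Lean document; each statement's English description precedes it below -/
import Mathlib

section
/- Let ζ be an initial segment of I, i ∈ ζ, and X ∈ Pe(ζ). Then the sets Spl(X,i,0) and Spl(X,i,1) also belong to Pe(ζ). -/
open Set

abbrev Cantor : Type := ℕ → Bool

section
variable {I : Type}

/-- Restriction of a point of `D^η` to `D^ξ` (for `ξ ⊆ η`). -/
def restrictFn {ξ η : Set I} (h : ξ ⊆ η) (x : ↥η → Cantor) : ↥ξ → Cantor :=
  fun j => x ⟨j.1, h j.2⟩

/-- Projection `X↾ξ` of a set `X ⊆ D^η`. -/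
def resSet {ξ η : Set I} (h : ξ ⊆ η) (X : Set (↥η → Cantor)) : Set (↥ξ → Cantor) :=
  restrictFn h '' X

/-- Inverse projection `Y↾⁻¹η` of a set `Y ⊆ D^ξ`. -/
def resPre {ξ η : Set I} (h : ξ ⊆ η) (Y : Set (↥ξ → Cantor)) : Set (↥η → Cantor) :=
  {y | restrictFn h y ∈ Y}

/-- `A` is (relatively) open in `B`. -/
def RelOpen {α : Type*} [TopologicalSpace α] (A B : Set α) : Prop :=
  ∃ U, IsOpen U ∧ A = U ∩ B

/-- `A` is (relatively) closed in `B`. -/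
def RelClosed {α : Type*} [TopologicalSpace α] (A B : Set α) : Prop :=
  ∃ U, IsClosed U ∧ A = U ∩ B

/-- `A` is (relatively) clopen in `B`. -/
def RelClopen {α : Type*} [TopologicalSpace α] (A B : Set α) : Prop :=
  RelOpen A B ∧ RelClosed A B

open Classical in
/-- The union `x ∪ y` of two partial points agreeing on the common domain. -/
noncomputable def glue {ξ η : Set I} (x : ↥ξ → Cantor) (y : ↥η → Cantor) :
    ↥(ξ ∪ η) → Cantor :=
  fun j => if h : j.1 ∈ ξ then x ⟨j.1, h⟩
           else y ⟨j.1, ((Set.mem_union j.1 ξ η).mp j.2).resolve_left h⟩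

variable [PartialOrder I]

/-- `[<i]`. -/
def seg (i : I) : Set I := {j | j < i}

/-- `[≤i]`. -/
def segLe (i : I) : Set I := {j | j ≤ i}

/-- `[≯i]`. -/
def segNG (i : I) : Set I := {j | ¬ i < j}

lemma seg_subset {ζ : Set I} (hζ : IsLowerSet ζ) {i : I} (hi : i ∈ ζ) : seg i ⊆ ζ :=
  fun _ hj => hζ (le_of_lt hj) hi

lemma segLe_subset {ζ : Set I} (hζ : IsLowerSet ζ) {i : I} (hi : i ∈ ζ) : segLe i ⊆ ζ :=
  fun _ hj => hζ hj hi

lemma isLowerSet_segLe (i : I) : IsLowerSet (segLe i) :=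
  fun _ _ hba ha => le_trans hba ha

lemma seg_subset_segLe (i : I) : seg i ⊆ segLe i :=
  fun _ hj => le_of_lt hj

lemma mem_segLe_self (i : I) : i ∈ segLe i := le_refl i

/-- `D_{Xz}(i) = {x(i) : x ∈ X, x↾(<i) = z}`. -/
def Dxz {ζ : Set I} (X : Set (↥ζ → Cantor)) {i : I} (hi : i ∈ ζ) (h : seg i ⊆ ζ)
    (z : ↥(seg i) → Cantor) : Set Cantor :=
  {c | ∃ x ∈ X, restrictFn h x = z ∧ x ⟨i, hi⟩ = c}

/-- Pre-conditions `IPe(ζ)`. -/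
def IPe (ζ : Set I) (hζ : IsLowerSet ζ) (X : Set (↥ζ → Cantor)) : Prop :=
  -- P-1
  (IsClosed X ∧ X.Nonempty) ∧
  -- P-2
  (∀ (i : I) (hi : i ∈ ζ), ∀ z ∈ resSet (seg_subset hζ hi) X,
      Perfect (Dxz X hi (seg_subset hζ hi) z)) ∧
  -- P-3
  (∀ (i : I) (hi : i ∈ ζ), ∀ G : Set Cantor, IsOpen G →
      RelOpen
        ({z | ∃ x ∈ X, x ⟨i, hi⟩ ∈ G ∧ restrictFn (seg_subset hζ hi) x = z} :
          Set (↥(seg i) → Cantor))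
        (resSet (seg_subset hζ hi) X)) ∧
  -- P-4
  (∀ ξ η : Set I, IsLowerSet ξ → IsLowerSet η → ∀ (hξ : ξ ⊆ ζ) (hη : η ⊆ ζ),
      ∀ x ∈ resSet hξ X, ∀ y ∈ resSet hη X,
        restrictFn (Set.inter_subset_left : ξ ∩ η ⊆ ξ) x =
          restrictFn (Set.inter_subset_right : ξ ∩ η ⊆ η) y →
        glue x y ∈ resSet (Set.union_subset hξ hη) X)

/-- `stem(A)`: the length of the longest common initial segment of members of `A`. -/
noncomputable def stem (A : Set Cantor) : ℕ :=
  sInf {n | ∃ a ∈ A, ∃ b ∈ A, a n ≠ b n}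

/-- `Spl(A,e)` for `A ⊆ D`. -/
def SplD (A : Set Cantor) (e : Bool) : Set Cantor :=
  {a ∈ A | a (stem A) = e}

/-- `Spl(X,i,e)` for `X ⊆ D^ζ`. -/
def Spl {ζ : Set I} (hζ : IsLowerSet ζ) (X : Set (↥ζ → Cantor)) {i : I} (hi : i ∈ ζ)
    (e : Bool) : Set (↥ζ → Cantor) :=
  {x ∈ X |
    x ⟨i, hi⟩ ∈
      SplD (Dxz X hi (seg_subset hζ hi) (restrictFn (seg_subset hζ hi) x)) e}

/-- A `ζ`-admissible function: `Φ : ω → ζ` taking each value of `ζ` infinitely often. -/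
def Admissible (ζ : Set I) (Φ : ℕ → I) : Prop :=
  (∀ n, Φ n ∈ ζ) ∧ ∀ i ∈ ζ, ∀ N : ℕ, ∃ n, N ≤ n ∧ Φ n = i

/-- The sets `X_Φ[u]` for finite binary sequences `u`. -/
def XPhi {ζ : Set I} (hζ : IsLowerSet ζ) (Φ : ℕ → I) (hΦ : ∀ n, Φ n ∈ ζ)
    (X : Set (↥ζ → Cantor)) : (m : ℕ) → (Fin m → Bool) → Set (↥ζ → Cantor)
  | 0, _ => X
  | m + 1, u =>
      Spl hζ (XPhi hζ Φ hΦ X m (fun k => u k.castSucc)) (hΦ m) (u (Fin.last m))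

/-- `X` is shrinkable: each `X_Φ[a]` is a singleton. -/
def Shrinkable {ζ : Set I} (hζ : IsLowerSet ζ) (X : Set (↥ζ → Cantor)) : Prop :=
  ∀ (Φ : ℕ → I) (hΦ : Admissible ζ Φ) (a : ℕ → Bool),
    ∃ x, (⋂ m : ℕ, XPhi hζ Φ hΦ.1 X m (fun k => a k.1)) = {x}

/-- Conditions `Pe(ζ)`: shrinkable pre-conditions. -/
def Pe (ζ : Set I) (hζ : IsLowerSet ζ) (X : Set (↥ζ → Cantor)) : Prop :=
  IPe ζ hζ X ∧ Shrinkable hζ X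

/-- `Perf = Pe(I)`. -/
def Perf (X : Set (↥(Set.univ : Set I) → Cantor)) : Prop :=
  Pe Set.univ isLowerSet_univ X

/-- The initial segments `ξ[u,v]`. -/
def xiUV (Φ : ℕ → I) : (m : ℕ) → (Fin m → Bool) → (Fin m → Bool) → Set I
  | 0, _, _ => Set.univ
  | m + 1, u, v =>
      if u (Fin.last m) = v (Fin.last m) then
        xiUV Φ m (fun k => u k.castSucc) (fun k => v k.castSucc)
      else
        xiUV Φ m (fun k => u k.castSucc) (fun k => v k.castSucc) ∩ segNG (Φ m)

/-- A `Φ`-splitting system of order `m`. -/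
def SplittingSystem (Φ : ℕ → I) (m : ℕ)
    (X : (n : ℕ) → (Fin n → Bool) → Set (↥(Set.univ : Set I) → Cantor)) : Prop :=
  (∀ n, n ≤ m → ∀ u : Fin n → Bool, Perf (X n u)) ∧
  -- S-1
  (∀ n, n < m → ∀ (u : Fin n → Bool) (e : Bool),
      X (n + 1) (Fin.snoc u e) ⊆
        Spl isLowerSet_univ (X n u) (Set.mem_univ (Φ n)) e) ∧
  -- S-2
  (∀ n, n ≤ m → ∀ u v : Fin n → Bool,
      resSet (Set.subset_univ (xiUV Φ n u v)) (X n u) =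
        resSet (Set.subset_univ (xiUV Φ n u v)) (X n v)) ∧
  -- S-3
  (∀ n, n ≤ m → ∀ u v : Fin n → Bool, ∀ i : I, i ∉ xiUV Φ n u v →
      resSet (Set.subset_univ (segLe i)) (X n u) ∩
        resSet (Set.subset_univ (segLe i)) (X n v) = ∅)

/-- `F` is reducible to `ξ` on `X`. -/
def Reducible {β : Type*} (F : (↥(Set.univ : Set I) → Cantor) → β) (ξ : Set I)
    (X : Set (↥(Set.univ : Set I) → Cantor)) : Prop :=
  ∀ x ∈ X, ∀ y ∈ X,
    restrictFn (Set.subset_univ ξ) x = restrictFn (Set.subset_univ ξ) y → F x = F y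

/-- `F` captures `i` on `X`. -/
def Captures {β : Type*} (F : (↥(Set.univ : Set I) → Cantor) → β) (i : I)
    (X : Set (↥(Set.univ : Set I) → Cantor)) : Prop :=
  ∀ x ∈ X, ∀ y ∈ X, F x = F y → x ⟨i, Set.mem_univ i⟩ = y ⟨i, Set.mem_univ i⟩

/-- Borel sets of finite level: level `0` = closed sets, level `n+1` = countable
unions or countable intersections of sets of level `n`. -/
def BorelLevel {α : Type*} [TopologicalSpace α] : ℕ → Set (Set α)
  | 0 => {C | IsClosed C}
  | n + 1 =>
      {S | (∃ f : ℕ → Set α, (∀ k, f k ∈ BorelLevel n) ∧ S = ⋃ k, f k) ∨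
           (∃ f : ℕ → Set α, (∀ k, f k ∈ BorelLevel n) ∧ S = ⋂ k, f k)}

end

section
variable {I : Type}

lemma restrictFn_eq_iff {ξ η : Set I} (h : ξ ⊆ η) (x y : ↥η → Cantor) :
    restrictFn h x = restrictFn h y ↔ ∀ j (hj : j ∈ ξ), x ⟨j, h hj⟩ = y ⟨j, h hj⟩ :=
  ⟨fun hxy j hj => congrFun hxy ⟨j, hj⟩, fun hxy => funext fun j => hxy j.1 j.2⟩

lemma continuous_restrictFn {ξ η : Set I} (h : ξ ⊆ η) :
    Continuous (restrictFn h : (↥η → Cantor) → ↥ξ → Cantor) :=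
  continuous_pi fun _ => continuous_apply _

lemma relOpen_iff_eventually {α : Type*} [TopologicalSpace α] {A B : Set α} :
    RelOpen A B ↔ A ⊆ B ∧ ∀ z ∈ A, ∀ᶠ z' in nhdsWithin z B, z' ∈ A := by
  constructor
  · rintro ⟨U, hU, rfl⟩
    refine ⟨Set.inter_subset_right, fun z hz => ?_⟩
    filter_upwards [self_mem_nhdsWithin, mem_nhdsWithin_of_mem_nhds (hU.mem_nhds hz.1)]
      with z' hB hU' using ⟨hU', hB⟩
  · rintro ⟨hAB, hA⟩
    refine ⟨interior {z | z ∈ B → z ∈ A}, isOpen_interior, Set.Subset.antisymm ?_ ?_⟩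
    · intro z hz
      exact ⟨mem_interior_iff_mem_nhds.2 (eventually_nhdsWithin_iff.1 (hA z hz)), hAB hz⟩
    · rintro z ⟨hz, hzB⟩
      exact interior_subset hz hzB

lemma isClopen_coord (n : ℕ) (e : Bool) : IsClopen {c : Cantor | c n = e} :=
  (isClopen_discrete {e}).preimage (continuous_apply n)

lemma Perfect.inter_isClopen {α : Type*} [TopologicalSpace α] {C U : Set α}
    (hC : Perfect C) (hU : IsClopen U) : Perfect (U ∩ C) :=
  ⟨hU.1.inter hC.closed, hC.acc.open_inter hU.2⟩

lemma Perfect.exists_apply_ne {A : Set Cantor} (hA : Perfect A) (hne : A.Nonempty) :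
    {n | ∃ a ∈ A, ∃ b ∈ A, a n ≠ b n}.Nonempty := by
  obtain ⟨a, ha⟩ := hne
  obtain ⟨b, ⟨-, hb⟩, hba⟩ := accPt_iff_nhds.1 (hA.acc a ha) Set.univ Filter.univ_mem
  obtain ⟨n, hn⟩ := Function.ne_iff.1 hba
  exact ⟨n, b, hb, a, ha, hn⟩

/-- The sequence `Φ` preceded by `i`. -/
def consSeq {α : Type*} (i : α) (Φ : ℕ → α) : ℕ → α
  | 0 => i
  | n + 1 => Φ n

lemma Admissible.consSeq {ζ : Set I} {i : I} {Φ : ℕ → I} (hΦ : Admissible ζ Φ) (hi : i ∈ ζ) :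
    Admissible ζ (consSeq i Φ) := by
  refine ⟨fun n => ?_, fun j hj N => ?_⟩
  · cases n with
    | zero => exact hi
    | succ n => exact hΦ.1 n
  · obtain ⟨n, hn, rfl⟩ := hΦ.2 j hj N
    exact ⟨n + 1, by omega, rfl⟩

variable [PartialOrder I] {ζ : Set I} {hζ : IsLowerSet ζ} {X : Set (↥ζ → Cantor)}
  {i : I} {hi : i ∈ ζ}

lemma mem_Dxz_restrictFn {x : ↥ζ → Cantor} (hx : x ∈ X) (h : seg i ⊆ ζ) :
    x ⟨i, hi⟩ ∈ Dxz X hi h (restrictFn h x) :=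
  ⟨x, hx, rfl, rfl⟩

lemma mem_Spl_iff {e : Bool} {x : ↥ζ → Cantor} :
    x ∈ Spl hζ X hi e ↔ x ∈ X ∧ x ⟨i, hi⟩
      (stem (Dxz X hi (seg_subset hζ hi) (restrictFn (seg_subset hζ hi) x))) = e :=
  ⟨fun h => ⟨h.1, h.2.2⟩, fun h => ⟨h.1, mem_Dxz_restrictFn h.1 _, h.2⟩⟩

lemma Spl_subset (e : Bool) : Spl hζ X hi e ⊆ X := fun _ h => h.1

lemma mem_Spl_of_agree {e : Bool} {x y : ↥ζ → Cantor} (hx : x ∈ X) (hy : y ∈ Spl hζ X hi e)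
    (hxy : ∀ j (hj : j ≤ i), x ⟨j, hζ hj hi⟩ = y ⟨j, hζ hj hi⟩) : x ∈ Spl hζ X hi e := by
  rw [mem_Spl_iff] at hy ⊢
  rw [(restrictFn_eq_iff (seg_subset hζ hi) x y).2 fun j hj => hxy j (le_of_lt hj),
    hxy i le_rfl]
  exact ⟨hx, hy.2⟩

lemma IPe.amalgamate (hX : IPe ζ hζ X) {ξ η : Set I} (hξ : IsLowerSet ξ) (hη : IsLowerSet η)
    (hξζ : ξ ⊆ ζ) (hηζ : η ⊆ ζ) {x y : ↥ζ → Cantor} (hx : x ∈ X) (hy : y ∈ X)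
    (hxy : ∀ j (hj : j ∈ ξ), j ∈ η → x ⟨j, hξζ hj⟩ = y ⟨j, hξζ hj⟩) :
    ∃ w ∈ X, (∀ j (hj : j ∈ ξ), w ⟨j, hξζ hj⟩ = x ⟨j, hξζ hj⟩) ∧
      ∀ j (hj : j ∈ η), w ⟨j, hηζ hj⟩ = y ⟨j, hηζ hj⟩ := by
  obtain ⟨w, hw, hwg⟩ := hX.2.2.2 ξ η hξ hη hξζ hηζ _ ⟨x, hx, rfl⟩ _ ⟨y, hy, rfl⟩
    (funext fun j => hxy j.1 j.2.1 j.2.2)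
  refine ⟨w, hw, fun j hj => ?_, fun j hj => ?_⟩
  · have := congrFun hwg ⟨j, Or.inl hj⟩
    simpa [glue, restrictFn, hj] using this
  · have := congrFun hwg ⟨j, Or.inr hj⟩
    by_cases hjξ : j ∈ ξ
    · simpa [glue, restrictFn, hjξ, hxy j hjξ hj] using this
    · simpa [glue, restrictFn, hjξ] using this

lemma IPe.split_nonempty (hX : IPe ζ hζ X) (hi : i ∈ ζ) {z : ↥(seg i) → Cantor}
    (hz : z ∈ resSet (seg_subset hζ hi) X) :
    {n | ∃ a ∈ Dxz X hi (seg_subset hζ hi) z, ∃ b ∈ Dxz X hi (seg_subset hζ hi) z,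
      a n ≠ b n}.Nonempty := by
  refine (hX.2.1 i hi z hz).exists_apply_ne ?_
  obtain ⟨x, hx, rfl⟩ := hz
  exact ⟨_, mem_Dxz_restrictFn hx _⟩

lemma IPe.exists_mem_Spl (hX : IPe ζ hζ X) (hi : i ∈ ζ) (e : Bool) {x : ↥ζ → Cantor}
    (hx : x ∈ X) : ∃ y ∈ Spl hζ X hi e,
      restrictFn (seg_subset hζ hi) y = restrictFn (seg_subset hζ hi) x := by
  obtain ⟨a, ⟨y, hy, hyx, rfl⟩, b, ⟨y', hy', hyx', rfl⟩, hne⟩ :=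
    Nat.sInf_mem (hX.split_nonempty hi ⟨x, hx, rfl⟩)
  change y _ (stem _) ≠ y' _ (stem _) at hne
  by_cases h : y ⟨i, hi⟩
      (stem (Dxz X hi (seg_subset hζ hi) (restrictFn (seg_subset hζ hi) x))) = e
  · exact ⟨y, mem_Spl_iff.2 ⟨hy, hyx ▸ h⟩, hyx⟩
  · refine ⟨y', mem_Spl_iff.2 ⟨hy', ?_⟩, hyx'⟩
    rw [hyx']
    revert h hne
    generalize y ⟨i, hi⟩ _ = p
    generalize y' ⟨i, hi⟩ _ = q
    revert p q e
    decide

lemma IPe.resSet_Spl_seg (hX : IPe ζ hζ X) (hi : i ∈ ζ) (e : Bool) :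
    resSet (seg_subset hζ hi) (Spl hζ X hi e) = resSet (seg_subset hζ hi) X := by
  refine Set.Subset.antisymm (Set.image_mono (Spl_subset e)) ?_
  rintro _ ⟨x, hx, rfl⟩
  exact hX.exists_mem_Spl hi e hx

lemma IPe.exists_mem_Spl_agree (hX : IPe ζ hζ X) (hi : i ∈ ζ) (e : Bool) {ξ : Set I}
    (hξ : IsLowerSet ξ) (hξζ : ξ ⊆ ζ) (hiξ : i ∉ ξ) {x : ↥ζ → Cantor} (hx : x ∈ X) :
    ∃ w ∈ Spl hζ X hi e, ∀ j (hj : j ∈ ξ), w ⟨j, hξζ hj⟩ = x ⟨j, hξζ hj⟩ := by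
  obtain ⟨y, hy, hyx⟩ := hX.exists_mem_Spl hi e hx
  rw [restrictFn_eq_iff] at hyx
  obtain ⟨w, hw, hwx, hwy⟩ := hX.amalgamate hξ (isLowerSet_segLe i) hξζ (segLe_subset hζ hi)
    hx hy.1 fun j hj hji =>
      (hyx j (lt_of_le_of_ne hji fun h => hiξ (h ▸ hj))).symm
  exact ⟨w, mem_Spl_of_agree hw hy hwy, hwx⟩

lemma IPe.exists_mem_Spl_agree_segLe (hX : IPe ζ hζ X) (hi : i ∈ ζ) (e : Bool) {j : I}
    (hj : j ∈ ζ) (hji : j ≠ i) {x : ↥ζ → Cantor} (hx : x ∈ X)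
    (hxj : restrictFn (seg_subset hζ hj) x ∈ resSet (seg_subset hζ hj) (Spl hζ X hi e)) :
    ∃ w ∈ Spl hζ X hi e, w ⟨j, hj⟩ = x ⟨j, hj⟩ ∧
      restrictFn (seg_subset hζ hj) w = restrictFn (seg_subset hζ hj) x := by
  by_cases hij : i ≤ j
  · obtain ⟨y, hy, hyx⟩ := hxj
    rw [restrictFn_eq_iff] at hyx
    exact ⟨x, mem_Spl_of_agree hx hy fun k hk =>
      (hyx k (lt_of_le_of_lt hk (lt_of_le_of_ne hij hji.symm))).symm, rfl, rfl⟩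
  · obtain ⟨w, hw, hwx⟩ := hX.exists_mem_Spl_agree hi e (isLowerSet_segLe j)
      (segLe_subset hζ hj) hij hx
    exact ⟨w, hw, hwx j le_rfl, (restrictFn_eq_iff _ _ _).2 fun k hk => hwx k (le_of_lt hk)⟩

lemma IPe.isClosed_hit (hX : IPe ζ hζ X) (hi : i ∈ ζ) (n : ℕ) (e : Bool) :
    IsClosed {z | ∃ x ∈ X, x ⟨i, hi⟩ n = e ∧ restrictFn (seg_subset hζ hi) x = z} := by
  have hc : IsCompact (X ∩ {x : ↥ζ → Cantor | x ⟨i, hi⟩ n = e}) :=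
    (hX.1.1.inter (isClosed_eq (by fun_prop) continuous_const)).isCompact
  convert (hc.image (continuous_restrictFn (seg_subset hζ hi))).isClosed using 1
  ext z
  simp only [Set.mem_ofPred_eq, Set.mem_image, Set.mem_inter_iff, and_assoc]

lemma IPe.eventually_stem_eq (hX : IPe ζ hζ X) (hi : i ∈ ζ) {z : ↥(seg i) → Cantor}
    (hz : z ∈ resSet (seg_subset hζ hi) X) :
    ∀ᶠ z' in nhdsWithin z (resSet (seg_subset hζ hi) X),
      stem (Dxz X hi (seg_subset hζ hi) z') = stem (Dxz X hi (seg_subset hζ hi) z) := by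
  set H : ℕ → Bool → Set (↥(seg i) → Cantor) := fun n e =>
    {z | ∃ x ∈ X, x ⟨i, hi⟩ n = e ∧ restrictFn (seg_subset hζ hi) x = z} with hH
  have hopen : ∀ n e, ∀ z ∈ H n e,
      ∀ᶠ z' in nhdsWithin z (resSet (seg_subset hζ hi) X), z' ∈ H n e := fun n e =>
    (relOpen_iff_eventually.1 (hX.2.2.1 i hi _ (isClopen_coord n e).2)).2
  have hsplit : ∀ n z, (∃ a ∈ Dxz X hi (seg_subset hζ hi) z,
      ∃ b ∈ Dxz X hi (seg_subset hζ hi) z, a n ≠ b n) ↔ z ∈ H n true ∩ H n false := by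
    intro n z
    constructor
    · rintro ⟨_, ⟨x, hx, hxz, rfl⟩, _, ⟨y, hy, hyz, rfl⟩, hne⟩
      cases hxn : x ⟨i, hi⟩ n
      · exact ⟨⟨y, hy, by simpa [hxn] using hne.symm, hyz⟩, x, hx, hxn, hxz⟩
      · exact ⟨⟨x, hx, hxn, hxz⟩, y, hy, by simpa [hxn] using hne.symm, hyz⟩
    · rintro ⟨⟨x, hx, hxn, hxz⟩, y, hy, hyn, hyz⟩
      exact ⟨_, ⟨x, hx, hxz, rfl⟩, _, ⟨y, hy, hyz, rfl⟩, by simp [hxn, hyn]⟩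
  have hmem := (hsplit _ z).1 (Nat.sInf_mem (hX.split_nonempty hi hz))
  change z ∈ H (stem _) true ∩ H (stem _) false at hmem
  set n := stem (Dxz X hi (seg_subset hζ hi) z) with hn
  have hlt : ∀ᶠ z' in nhdsWithin z (resSet (seg_subset hζ hi) X),
      ∀ k ∈ Set.Iio n, z' ∉ H k true ∩ H k false := by
    refine (Filter.eventually_all_finite (Set.finite_Iio n)).2 fun k hk => ?_
    have hzk : z ∉ H k true ∩ H k false := fun h =>
      Nat.notMem_of_lt_sInf (show k < sInf _ from hk) ((hsplit k z).2 h)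
    exact mem_nhdsWithin_of_mem_nhds
      (((hX.isClosed_hit hi k true).inter (hX.isClosed_hit hi k false)).isOpen_compl.mem_nhds hzk)
  filter_upwards [hopen n true z hmem.1, hopen n false z hmem.2, hlt] with z' h1 h2 h3
  refine le_antisymm (Nat.sInf_le ((hsplit n z').2 ⟨h1, h2⟩)) ?_
  refine le_csInf ⟨n, (hsplit n z').2 ⟨h1, h2⟩⟩ fun k hk => ?_
  by_contra hkn
  exact h3 k (not_le.1 hkn) ((hsplit k z').1 hk)

lemma IPe.isClosed_Spl (hX : IPe ζ hζ X) (hi : i ∈ ζ) (e : Bool) :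
    IsClosed (Spl hζ X hi e) := by
  refine isClosed_of_closure_subset fun x hx => ?_
  have hxX : x ∈ X := hX.1.1.closure_subset_iff.2 (Spl_subset e) hx
  have hfreq := mem_closure_iff_frequently.1 hx
  have hstem := eventually_nhdsWithin_iff.1 (hX.eventually_stem_eq hi ⟨x, hxX, rfl⟩)
  have hstem' := ((continuous_restrictFn (seg_subset hζ hi)).tendsto x).eventually hstem
  have hcoord : ∀ᶠ y : ↥ζ → Cantor in nhds x, y ⟨i, hi⟩
      (stem (Dxz X hi (seg_subset hζ hi) (restrictFn (seg_subset hζ hi) x))) = x ⟨i, hi⟩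
      (stem (Dxz X hi (seg_subset hζ hi) (restrictFn (seg_subset hζ hi) x))) :=
    ((continuous_apply (⟨i, hi⟩ : ↥ζ)).tendsto x).eventually
      ((isClopen_coord _ _).2.mem_nhds rfl)
  obtain ⟨y, hy, hs, hc⟩ := (hfreq.and_eventually (hstem'.and hcoord)).exists
  rw [mem_Spl_iff] at hy ⊢
  refine ⟨hxX, ?_⟩
  rw [← hc, ← hs ⟨y, hy.1, rfl⟩]
  exact hy.2

lemma Dxz_Spl_self (e : Bool) (z : ↥(seg i) → Cantor) :
    Dxz (Spl hζ X hi e) hi (seg_subset hζ hi) z =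
      {c | c (stem (Dxz X hi (seg_subset hζ hi) z)) = e} ∩ Dxz X hi (seg_subset hζ hi) z := by
  ext c
  constructor
  · rintro ⟨x, hx, rfl, rfl⟩
    exact ⟨(mem_Spl_iff.1 hx).2, mem_Dxz_restrictFn hx.1 _⟩
  · rintro ⟨hc, x, hx, rfl, rfl⟩
    exact mem_Dxz_restrictFn (mem_Spl_iff.2 ⟨hx, hc⟩) _

lemma IPe.perfect_Dxz_Spl (hX : IPe ζ hζ X) (hi : i ∈ ζ) (e : Bool) {j : I} (hj : j ∈ ζ)
    {z : ↥(seg j) → Cantor} (hz : z ∈ resSet (seg_subset hζ hj) (Spl hζ X hi e)) :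
    Perfect (Dxz (Spl hζ X hi e) hj (seg_subset hζ hj) z) := by
  have hD := hX.2.1 j hj z (Set.image_mono (Spl_subset e) hz)
  by_cases hji : j = i
  · subst hji
    rw [Dxz_Spl_self]
    exact hD.inter_isClopen (isClopen_coord _ e)
  · convert hD using 1
    ext c
    constructor
    · rintro ⟨x, hx, hxz, rfl⟩
      exact ⟨x, hx.1, hxz, rfl⟩
    · rintro ⟨x, hx, rfl, rfl⟩
      obtain ⟨w, hw, hwj, hwx⟩ := hX.exists_mem_Spl_agree_segLe hi e hj hji hx hz
      exact ⟨w, hw, hwx, hwj⟩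

lemma IPe.relOpen_Spl (hX : IPe ζ hζ X) (hi : i ∈ ζ) (e : Bool) {j : I} (hj : j ∈ ζ)
    {G : Set Cantor} (hG : IsOpen G) :
    RelOpen {z | ∃ x ∈ Spl hζ X hi e, x ⟨j, hj⟩ ∈ G ∧ restrictFn (seg_subset hζ hj) x = z}
      (resSet (seg_subset hζ hj) (Spl hζ X hi e)) := by
  by_cases hji : j = i
  · subst hji
    rw [hX.resSet_Spl_seg, relOpen_iff_eventually]
    constructor
    · rintro z ⟨x, hx, -, rfl⟩
      exact ⟨x, hx.1, rfl⟩
    · rintro z ⟨x, hx, hxG, rfl⟩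
      rw [mem_Spl_iff] at hx
      have hGe := relOpen_iff_eventually.1 (hX.2.2.1 j hj _ (hG.inter (isClopen_coord
        (stem (Dxz X hj (seg_subset hζ hj) (restrictFn (seg_subset hζ hj) x))) e).2))
      filter_upwards [hGe.2 _ ⟨x, hx.1, ⟨hxG, hx.2⟩, rfl⟩,
        hX.eventually_stem_eq hj ⟨x, hx.1, rfl⟩]
      rintro _ ⟨y, hy, ⟨hyG, hye⟩, rfl⟩ hs
      refine ⟨y, mem_Spl_iff.2 ⟨hy, ?_⟩, hyG, rfl⟩
      rw [hs]
      exact hye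
  · obtain ⟨U, hU, hUX⟩ := hX.2.2.1 j hj G hG
    refine ⟨U, hU, Set.Subset.antisymm ?_ ?_⟩
    · rintro z ⟨x, hx, hxG, rfl⟩
      exact ⟨(hUX.subset ⟨x, hx.1, hxG, rfl⟩).1, x, hx, rfl⟩
    · rintro z ⟨hzU, hz⟩
      obtain ⟨x, hx, hxG, rfl⟩ := hUX.superset ⟨hzU, Set.image_mono (Spl_subset e) hz⟩
      obtain ⟨w, hw, hwj, hwx⟩ := hX.exists_mem_Spl_agree_segLe hi e hj hji hx hz
      exact ⟨w, hw, hwj ▸ hxG, hwx⟩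

lemma IPe.glue_mem_Spl (hX : IPe ζ hζ X) (hi : i ∈ ζ) (e : Bool) {ξ η : Set I}
    (hξ : IsLowerSet ξ) (hη : IsLowerSet η) (hξζ : ξ ⊆ ζ) (hηζ : η ⊆ ζ)
    {x y : ↥ζ → Cantor} (hx : x ∈ Spl hζ X hi e) (hy : y ∈ Spl hζ X hi e)
    (hxy : ∀ j (hj : j ∈ ξ), j ∈ η → x ⟨j, hξζ hj⟩ = y ⟨j, hξζ hj⟩) :
    glue (restrictFn hξζ x) (restrictFn hηζ y) ∈
      resSet (Set.union_subset hξζ hηζ) (Spl hζ X hi e) := by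
  suffices h : ∃ w ∈ Spl hζ X hi e, (∀ j (hj : j ∈ ξ), w ⟨j, hξζ hj⟩ = x ⟨j, hξζ hj⟩) ∧
      ∀ j (hj : j ∈ η), w ⟨j, hηζ hj⟩ = y ⟨j, hηζ hj⟩ by
    obtain ⟨w, hw, hwx, hwy⟩ := h
    refine ⟨w, hw, funext fun ⟨j, hj⟩ => ?_⟩
    by_cases hjξ : j ∈ ξ
    · simpa [glue, restrictFn, hjξ] using hwx j hjξ
    · simpa [glue, restrictFn, hjξ] using hwy j (hj.resolve_left hjξ)
  obtain ⟨w, hw, hwx, hwy⟩ := hX.amalgamate hξ hη hξζ hηζ hx.1 hy.1 hxy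
  by_cases hiξ : i ∈ ξ
  · exact ⟨w, mem_Spl_of_agree hw hx fun j hj => hwx j (hξ hj hiξ), hwx, hwy⟩
  by_cases hiη : i ∈ η
  · exact ⟨w, mem_Spl_of_agree hw hy fun j hj => hwy j (hη hj hiη), hwx, hwy⟩
  obtain ⟨v, hv, hvw⟩ := hX.exists_mem_Spl_agree hi e (hξ.union hη)
    (Set.union_subset hξζ hηζ) (fun h => h.elim hiξ hiη) hw
  exact ⟨v, hv, fun j hj => (hvw j (Or.inl hj)).trans (hwx j hj),
    fun j hj => (hvw j (Or.inr hj)).trans (hwy j hj)⟩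

lemma IPe.spl (hX : IPe ζ hζ X) (hi : i ∈ ζ) (e : Bool) : IPe ζ hζ (Spl hζ X hi e) := by
  refine ⟨⟨hX.isClosed_Spl hi e, ?_⟩, fun j hj z hz => hX.perfect_Dxz_Spl hi e hj hz,
    fun j hj G hG => hX.relOpen_Spl hi e hj hG, ?_⟩
  · obtain ⟨x, hx⟩ := hX.1.2
    obtain ⟨y, hy, -⟩ := hX.exists_mem_Spl hi e hx
    exact ⟨y, hy⟩
  · rintro ξ η hξ hη hξζ hηζ _ ⟨x, hx, rfl⟩ _ ⟨y, hy, rfl⟩ hxy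
    exact hX.glue_mem_Spl hi e hξ hη hξζ hηζ hx hy fun j hj hj' => congrFun hxy ⟨j, hj, hj'⟩

lemma XPhi_consSeq {Φ : ℕ → I} (hΦ : ∀ n, Φ n ∈ ζ) (hi : i ∈ ζ)
    (hΦ' : ∀ n, consSeq i Φ n ∈ ζ) (m : ℕ) (u : Fin (m + 1) → Bool) :
    XPhi hζ (consSeq i Φ) hΦ' X (m + 1) u =
      XPhi hζ Φ hΦ (Spl hζ X hi (u 0)) m fun k => u k.succ := by
  induction m with
  | zero => rfl
  | succ m ih =>
    rw [XPhi, ih]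
    rfl

lemma Shrinkable.spl (hX : Shrinkable hζ X) (hi : i ∈ ζ) (e : Bool) :
    Shrinkable hζ (Spl hζ X hi e) := by
  intro Φ hΦ a
  obtain ⟨x, hx⟩ := hX (consSeq i Φ) (hΦ.consSeq hi) (consSeq e a)
  refine ⟨x, hx ▸ ?_⟩
  have hshift : ∀ m, XPhi hζ (consSeq i Φ) (hΦ.consSeq hi).1 X (m + 1)
      (fun k => consSeq e a k.1) =
        XPhi hζ Φ hΦ.1 (Spl hζ X hi e) m (fun k => a k.1) := fun m =>
    XPhi_consSeq hΦ.1 hi (hΦ.consSeq hi).1 m _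
  ext y
  simp only [Set.mem_iInter]
  constructor
  · rintro h (_ | m)
    · exact Spl_subset e (h 0)
    · exact (hshift m).symm ▸ h m
  · intro h m
    exact hshift m ▸ h (m + 1)

end

theorem stmt8 (I : Type) [PartialOrder I] [Countable I]
    (ζ : Set I) (hζ : IsLowerSet ζ) (i : I) (hi : i ∈ ζ)
    (X : Set (↥ζ → Cantor)) (hX : Pe ζ hζ X) :
    ∀ e : Bool, Pe ζ hζ (Spl hζ X hi e) :=
  fun e => ⟨hX.1.spl hi e, hX.2.spl hi e⟩
end

section
/- Let F ∈ Cont and X ∈ Perf. If F is reducible to both ξ and η (initial segments of I) on X, then F is reducible to ξ ∩ η on X. -/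
open Set

theorem stmt16 (I : Type) [PartialOrder I] [Countable I]
    (F : (↥(Set.univ : Set I) → Cantor) → (ℕ → ℕ)) (hF : Continuous F)
    (X : Set (↥(Set.univ : Set I) → Cantor)) (hX : Perf X)
    (ξ η : Set I) (hξ : IsLowerSet ξ) (hη : IsLowerSet η)
    (h1 : Reducible F ξ X) (h2 : Reducible F η X) :
    Reducible F (ξ ∩ η) X := by
  intro x hx y hy hxy
  obtain ⟨z, hz, hzg⟩ := hX.1.2.2.2 ξ η hξ hη (subset_univ ξ) (subset_univ η)
    (restrictFn (subset_univ ξ) x) ⟨x, hx, rfl⟩ (restrictFn (subset_univ η) y) ⟨y, hy, rfl⟩ hxy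
  have hxz : restrictFn (subset_univ ξ) x = restrictFn (subset_univ ξ) z := by
    funext j
    have h := congrFun hzg ⟨j.1, Or.inl j.2⟩
    simp only [glue, j.2, dite_true] at h
    exact h.symm
  have hzy : restrictFn (subset_univ η) z = restrictFn (subset_univ η) y := by
    funext j
    have h := congrFun hzg ⟨j.1, Or.inr j.2⟩
    by_cases hj : j.1 ∈ ξ
    · simp only [glue, hj, dite_true] at h
      exact h.trans (congrFun hxy ⟨j.1, hj, j.2⟩)
    · simp only [glue, hj, dite_false] at h
      exact h
  exact (h1 x hx z hz hxz).trans (h2 z hz y hy hzy)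
end
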